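/- arXiv:2103.14343 — 4 statements merged into one kernel-verified Lean document; each statement's English description precedes it below -/
import Mathlib

section
/- Let B ∈ ℝ^{p×s} and μ, ρ > 0, and set E := ((μ/ρ)I_s + BᵀB)⁻¹Bᵀ and G := I_p − BE. Then GᵀG + (μ/ρ)EᵀE = G. -/
open Matrix

/-- A solution `E` of the regularized normal equation `(cI + BᵀB)E = Bᵀ` has residual `G = I − BE`
satisfying `GᵀG + cEᵀE = G`. -/
theorem residual_transpose_mul_self_add {m n R : Type*} [Fintype m] [DecidableEq m]
    [Fintype n] [DecidableEq n] [CommRing R] {B : Matrix m n R} {E : Matrix n m R} {c : R}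
    (h : (c • (1 : Matrix n n R) + Bᵀ * B) * E = Bᵀ) :
    (1 - B * E)ᵀ * (1 - B * E) + c • (Eᵀ * E) = 1 - B * E := by
  have hc : c • E = Bᵀ * (1 - B * E) := by
    rw [Matrix.add_mul, Matrix.smul_mul, Matrix.one_mul, Matrix.mul_assoc] at h
    rw [Matrix.mul_sub, Matrix.mul_one, eq_sub_iff_add_eq, h]
  rw [← Matrix.mul_smul, hc, ← Matrix.mul_assoc, ← Matrix.add_mul, transpose_sub, transpose_one,
    transpose_mul, sub_add_cancel, Matrix.one_mul]

/-- With `E := ((μ/ρ)I + BᵀB)⁻¹Bᵀ` and `G := I − BE`,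
one has `GᵀG + (μ/ρ)EᵀE = G`. -/
theorem stmt_8 (p s : ℕ) (B : Matrix (Fin p) (Fin s) ℝ) (μ ρ : ℝ)
    (hμ : 0 < μ) (hρ : 0 < ρ) :
    let E := ((μ / ρ) • (1 : Matrix (Fin s) (Fin s) ℝ) + Bᵀ * B)⁻¹ * Bᵀ
    let G := (1 : Matrix (Fin p) (Fin p) ℝ) - B * E
    Gᵀ * G + (μ / ρ) • (Eᵀ * E) = G := by
  have hM : ((μ / ρ) • (1 : Matrix (Fin s) (Fin s) ℝ) + Bᵀ * B).PosDef :=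
    (PosDef.one.smul (div_pos hμ hρ)).add_posSemidef (posSemidef_conjTranspose_mul_self B)
  exact residual_transpose_mul_self_add
    (mul_nonsing_inv_cancel_left _ _ ((isUnit_iff_isUnit_det _).mp hM.isUnit))
end

section
/- Let M ∈ ℝ^{r×r} be symmetric positive definite, A ∈ ℝ^{p×r}, B ∈ ℝ^{p×s}, and μ, ρ > 0. Set G := I_p − B((μ/ρ)I_s + BᵀB)⁻¹Bᵀ, S := (M⁻¹ + ρAᵀGA)⁻¹, P := ρSAᵀG, and M₊ := (1/ρ)I_p + (1/μ)BBᵀ + AMAᵀ. Then PᵀM⁻¹P + ρ(I_p − AP)ᵀG(I_p − AP) = ρG − ρ²GASAᵀG = M₊⁻¹. -/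
open Matrix

namespace Matrix

variable {m n k : Type*} [Fintype m] [DecidableEq m] [Fintype n] [DecidableEq n]
  [Fintype k]

theorem PosDef.smul_one_add_mul_transpose {a b : ℝ} (ha : 0 < a) (hb : 0 ≤ b)
    (B : Matrix m k ℝ) : (a • (1 : Matrix m m ℝ) + b • (B * Bᵀ)).PosDef := by
  have h : (B * Bᵀ).PosSemidef := by
    simpa [conjTranspose_eq_transpose_of_trivial] using posSemidef_self_mul_conjTranspose B
  exact (PosDef.one.smul ha).add_posSemidef (h.smul hb)

/-- The push-through form of the inverse of `ρ⁻¹ I + μ⁻¹ B Bᵀ`. -/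
theorem inv_smul_one_add_smul_mul_transpose [DecidableEq k] {μ ρ : ℝ} (hμ : 0 < μ) (hρ : 0 < ρ)
    (B : Matrix m k ℝ) :
    ((1 / ρ) • (1 : Matrix m m ℝ) + (1 / μ) • (B * Bᵀ))⁻¹ =
      ρ • (1 - B * (((μ / ρ) • (1 : Matrix k k ℝ) + Bᵀ * B)⁻¹ * Bᵀ)) := by
  set K := (μ / ρ) • (1 : Matrix k k ℝ) + Bᵀ * B with hK
  have hKpd : K.PosDef := by
    simpa [hK] using PosDef.smul_one_add_mul_transpose (div_pos hμ hρ) zero_le_one Bᵀ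
  have hKdet : IsUnit K.det := (isUnit_iff_isUnit_det K).mp hKpd.isUnit
  have hBN : Bᵀ * ((1 / ρ) • (1 : Matrix m m ℝ) + (1 / μ) • (B * Bᵀ)) = (1 / μ) • (K * Bᵀ) := by
    have hc : μ⁻¹ * (μ / ρ) = ρ⁻¹ := by field_simp
    simp [hK, Matrix.mul_add, Matrix.add_mul, smul_smul, hc, Matrix.mul_assoc]
  apply inv_eq_left_inv
  rw [Matrix.smul_mul, Matrix.sub_mul, Matrix.one_mul, Matrix.mul_assoc, Matrix.mul_assoc, hBN, Matrix.mul_smul,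
    nonsing_inv_mul_cancel_left _ _ hKdet, Matrix.mul_smul, add_sub_cancel_right, smul_smul,
    mul_one_div_cancel hρ.ne', one_smul]

/-- Completing the square in the Joseph form of the covariance update. -/
theorem joseph_form {R : Type*} [CommRing R] {W S : Matrix n n R} {H : Matrix m m R}
    (A : Matrix m n R) (hH : Hᵀ = H) (hS : Sᵀ = S) (hWS : (W + Aᵀ * H * A) * S = 1) :
    (S * Aᵀ * H)ᵀ * W * (S * Aᵀ * H) + (1 - A * (S * Aᵀ * H))ᵀ * H * (1 - A * (S * Aᵀ * H)) =
      H - H * A * S * Aᵀ * H := by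
  have key : H * A * S * ((W + Aᵀ * H * A) * S) * Aᵀ * H = H * A * S * Aᵀ * H := by
    rw [hWS, Matrix.mul_one]
  simp only [transpose_sub, transpose_mul, transpose_one, transpose_transpose, hH, hS,
    Matrix.mul_add, Matrix.add_mul, Matrix.mul_sub, Matrix.sub_mul, Matrix.mul_one,
    Matrix.one_mul, Matrix.mul_assoc] at key ⊢
  rw [eq_sub_of_add_eq key]
  abel

end Matrix

/-- With `P := ρSAᵀG`, one has
`PᵀM⁻¹P + ρ(I − AP)ᵀG(I − AP) = ρG − ρ²GASAᵀG = M₊⁻¹`. -/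
theorem stmt_14 (r p s : ℕ) (M : Matrix (Fin r) (Fin r) ℝ) (hM : M.PosDef)
    (A : Matrix (Fin p) (Fin r) ℝ) (B : Matrix (Fin p) (Fin s) ℝ)
    (μ ρ : ℝ) (hμ : 0 < μ) (hρ : 0 < ρ) :
    let E := ((μ / ρ) • (1 : Matrix (Fin s) (Fin s) ℝ) + Bᵀ * B)⁻¹ * Bᵀ
    let G := (1 : Matrix (Fin p) (Fin p) ℝ) - B * E
    let S := (M⁻¹ + ρ • (Aᵀ * G * A))⁻¹
    let P := ρ • (S * Aᵀ * G)
    let Mplus := (1 / ρ) • (1 : Matrix (Fin p) (Fin p) ℝ) + (1 / μ) • (B * Bᵀ) + A * M * Aᵀ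
    Pᵀ * M⁻¹ * P + ρ • (((1 : Matrix (Fin p) (Fin p) ℝ) - A * P)ᵀ * G * ((1 : Matrix (Fin p) (Fin p) ℝ) - A * P))
        = ρ • G - (ρ ^ 2) • (G * A * S * Aᵀ * G)
      ∧ ρ • G - (ρ ^ 2) • (G * A * S * Aᵀ * G) = Mplus⁻¹ := by
  intro E G S P Mplus
  set N := (1 / ρ) • (1 : Matrix (Fin p) (Fin p) ℝ) + (1 / μ) • (B * Bᵀ)
  have hN : N.PosDef :=
    PosDef.smul_one_add_mul_transpose (one_div_pos.mpr hρ) (one_div_pos.mpr hμ).le B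
  have hNinv : N⁻¹ = ρ • G := inv_smul_one_add_smul_mul_transpose hμ hρ B
  have hGpd : (ρ • G).PosDef := hNinv ▸ hN.inv
  have hGt : (ρ • G)ᵀ = ρ • G := hGpd.isHermitian
  have hT : (M⁻¹ + Aᵀ * (ρ • G) * A).PosDef :=
    hM.inv.add_posSemidef (by
      simpa [conjTranspose_eq_transpose_of_trivial] using
        hGpd.posSemidef.conjTranspose_mul_mul_same A)
  have hSeq : S = (M⁻¹ + Aᵀ * (ρ • G) * A)⁻¹ := by simp [S]
  have hSt : Sᵀ = S := by
    rw [hSeq]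
    exact hT.inv.isHermitian
  have hTS : (M⁻¹ + Aᵀ * (ρ • G) * A) * S = 1 := by
    rw [hSeq]
    exact mul_nonsing_inv _ ((isUnit_iff_isUnit_det _).mp hT.isUnit)
  have hP : P = S * Aᵀ * (ρ • G) := by simp [P]
  have hsq : (ρ ^ 2) • (G * A * S * Aᵀ * G) = (ρ • G) * A * S * Aᵀ * (ρ • G) := by
    simp [smul_smul, sq]
  constructor
  · rw [hsq, ← joseph_form A hGt hSt hTS, ← hP, Matrix.mul_smul (1 - A * P)ᵀ ρ G,
      Matrix.smul_mul]
  · have hW := add_mul_mul_inv_eq_sub N A M Aᵀ hN.isUnit hM.isUnit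
      (by rw [hNinv]; exact hT.isUnit)
    rw [hNinv, ← hSeq] at hW
    rw [hsq, ← hW]
end

section
/- Let M ∈ ℝ^{r×r} be symmetric positive definite, A ∈ ℝ^{p×r}, B ∈ ℝ^{p×s}, μ, ρ > 0, q ∈ ℝʳ and c ∈ ℝᵖ. Set E := ((μ/ρ)I_s + BᵀB)⁻¹Bᵀ, G := I_p − BE and S := (M⁻¹ + ρAᵀGA)⁻¹. Then the function (x, w) ↦ (1/2)(M⁻¹x − q)ᵀM(M⁻¹x − q) + (ρ/2)‖Ax + Bw + c‖² + (μ/2)‖w‖² on ℝʳ × ℝˢ has a unique global minimizer (x*, w*), given by x* = Sq − ρSAᵀGc and w* = −E(Ax* + c). -/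
open Matrix

lemma posDef_smul_one_add_transpose_mul_self {p s : ℕ}
    (B : Matrix (Fin p) (Fin s) ℝ) {t : ℝ} (ht : 0 < t) :
    (t • (1 : Matrix (Fin s) (Fin s) ℝ) + Bᵀ * B).PosDef := by
  refine (PosDef.one.smul ht).add_posSemidef ?_
  simpa using posSemidef_conjTranspose_mul_self B

/-- The regularised residual map `G = 1 - B * E` satisfies `Bᵀ * G = t • E`. -/
lemma transpose_mul_one_sub_mul {p s : ℕ}
    {B : Matrix (Fin p) (Fin s) ℝ} {E : Matrix (Fin s) (Fin p) ℝ}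
    {t : ℝ} (h : (t • (1 : Matrix (Fin s) (Fin s) ℝ) + Bᵀ * B) * E = Bᵀ) :
    Bᵀ * (1 - B * E) = t • E := by
  rw [Matrix.mul_sub, Matrix.mul_one, ← Matrix.mul_assoc, sub_eq_iff_eq_add]
  rw [Matrix.add_mul, Matrix.smul_mul, Matrix.one_mul] at h
  exact h.symm

lemma posSemidef_one_sub_mul {p s : ℕ}
    {B : Matrix (Fin p) (Fin s) ℝ} {E : Matrix (Fin s) (Fin p) ℝ}
    {t : ℝ} (ht : 0 < t) (h : Bᵀ * (1 - B * E) = t • E) :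
    (1 - B * E).PosSemidef := by
  have key : 1 - B * E = (1 - B * E)ᵀ * (1 - B * E) + t • (Eᵀ * E) := by
    have hone : (1 - B * E)ᵀ + Eᵀ * Bᵀ = 1 := by
      rw [← transpose_mul, ← transpose_add, sub_add_cancel, transpose_one]
    rw [← Matrix.mul_smul, ← h, ← Matrix.mul_assoc, ← Matrix.add_mul, hone, Matrix.one_mul]
  rw [key]
  simp only [← conjTranspose_eq_transpose_of_trivial]
  exact (posSemidef_conjTranspose_mul_self (1 - B * E)).add
    ((posSemidef_conjTranspose_mul_self E).smul ht.le)

/-- Expansion of a regularised least-squares objective around a stationary point, which shows that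
the stationary point is the strict global minimizer. -/
lemma lt_of_stationary {r p s : ℕ}
    {M : Matrix (Fin r) (Fin r) ℝ} (hM : M.PosDef)
    (A : Matrix (Fin p) (Fin r) ℝ) (B : Matrix (Fin p) (Fin s) ℝ)
    {μ ρ : ℝ} (hμ : 0 < μ) (hρ : 0 < ρ) (q : Fin r → ℝ) (c : Fin p → ℝ)
    {x₀ x : Fin r → ℝ} {w₀ w : Fin s → ℝ}
    (hx : M⁻¹ *ᵥ x₀ - q + ρ • (Aᵀ *ᵥ (A *ᵥ x₀ + B *ᵥ w₀ + c)) = 0)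
    (hw : ρ • (Bᵀ *ᵥ (A *ᵥ x₀ + B *ᵥ w₀ + c)) + μ • w₀ = 0)
    (hne : (x, w) ≠ (x₀, w₀)) :
    (1 / 2) * ((M⁻¹ *ᵥ x₀ - q) ⬝ᵥ (M *ᵥ (M⁻¹ *ᵥ x₀ - q)))
        + (ρ / 2) * ((A *ᵥ x₀ + B *ᵥ w₀ + c) ⬝ᵥ (A *ᵥ x₀ + B *ᵥ w₀ + c))
        + (μ / 2) * (w₀ ⬝ᵥ w₀) <
    (1 / 2) * ((M⁻¹ *ᵥ x - q) ⬝ᵥ (M *ᵥ (M⁻¹ *ᵥ x - q)))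
        + (ρ / 2) * ((A *ᵥ x + B *ᵥ w + c) ⬝ᵥ (A *ᵥ x + B *ᵥ w + c))
        + (μ / 2) * (w ⬝ᵥ w) := by
  obtain ⟨d, rfl⟩ : ∃ d, x = x₀ + d := ⟨x - x₀, by abel⟩
  obtain ⟨e, rfl⟩ : ∃ e, w = w₀ + e := ⟨w - w₀, by abel⟩
  set u := M⁻¹ *ᵥ x₀ - q with hu
  set v := A *ᵥ x₀ + B *ᵥ w₀ + c with hv
  have hu' : M⁻¹ *ᵥ (x₀ + d) - q = u + M⁻¹ *ᵥ d := by rw [mulVec_add, hu]; abel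
  have hv' : A *ᵥ (x₀ + d) + B *ᵥ (w₀ + e) + c = v + (A *ᵥ d + B *ᵥ e) := by
    rw [mulVec_add, mulVec_add, hv]; abel
  have hMd : M *ᵥ (M⁻¹ *ᵥ d) = d := by
    rw [mulVec_mulVec, mul_nonsing_inv _ ((isUnit_iff_isUnit_det M).1 hM.isUnit), one_mulVec]
  have hMT : Mᵀ = M := by simpa using hM.isHermitian.eq
  have hcross : (M⁻¹ *ᵥ d) ⬝ᵥ (M *ᵥ u) = d ⬝ᵥ u := by
    rw [dotProduct_mulVec, ← mulVec_transpose, hMT, hMd]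
  have hxd := congrArg (d ⬝ᵥ ·) hx
  have hwe := congrArg (e ⬝ᵥ ·) hw
  simp only [dotProduct_add, dotProduct_smul, smul_eq_mul, dotProduct_zero, dotProduct_mulVec,
    vecMul_transpose] at hxd hwe
  have hd : 0 ≤ d ⬝ᵥ (M⁻¹ *ᵥ d) := by simpa using hM.inv.posSemidef.dotProduct_mulVec_nonneg d
  have hee : 0 ≤ e ⬝ᵥ e := by simpa using dotProduct_star_self_nonneg e
  have hr : 0 ≤ (A *ᵥ d + B *ᵥ e) ⬝ᵥ (A *ᵥ d + B *ᵥ e) := by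
    simpa using dotProduct_star_self_nonneg (A *ᵥ d + B *ᵥ e)
  have hpos : 0 < d ⬝ᵥ (M⁻¹ *ᵥ d) + μ * (e ⬝ᵥ e) := by
    by_cases hd0 : d = 0
    · have he0 : e ≠ 0 := by rintro rfl; simp [hd0] at hne
      have : 0 < e ⬝ᵥ e := by simpa using dotProduct_star_self_pos_iff.2 he0
      positivity
    · have : 0 < d ⬝ᵥ (M⁻¹ *ᵥ d) := by simpa using hM.inv.dotProduct_mulVec_pos hd0
      positivity
  have h₁ : (u + M⁻¹ *ᵥ d) ⬝ᵥ (M *ᵥ (u + M⁻¹ *ᵥ d)) =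
      u ⬝ᵥ (M *ᵥ u) + 2 * (d ⬝ᵥ u) + d ⬝ᵥ (M⁻¹ *ᵥ d) := by
    rw [mulVec_add, hMd, dotProduct_add, add_dotProduct, add_dotProduct, hcross,
      dotProduct_comm u d, dotProduct_comm (M⁻¹ *ᵥ d) d]
    ring
  have h₂ : (v + (A *ᵥ d + B *ᵥ e)) ⬝ᵥ (v + (A *ᵥ d + B *ᵥ e)) =
      v ⬝ᵥ v + 2 * ((A *ᵥ d) ⬝ᵥ v + (B *ᵥ e) ⬝ᵥ v) +
        (A *ᵥ d + B *ᵥ e) ⬝ᵥ (A *ᵥ d + B *ᵥ e) := by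
    rw [← add_dotProduct (A *ᵥ d), add_dotProduct v, dotProduct_add v,
      dotProduct_comm v (A *ᵥ d + B *ᵥ e), dotProduct_add _ v]
    ring
  have h₃ : (w₀ + e) ⬝ᵥ (w₀ + e) = w₀ ⬝ᵥ w₀ + 2 * (e ⬝ᵥ w₀) + e ⬝ᵥ e := by
    rw [add_dotProduct, dotProduct_add, dotProduct_add, dotProduct_comm w₀ e]
    ring
  rw [hu', hv', h₁, h₂, h₃]
  have := mul_nonneg hρ.le hr
  linarith

/-- The final FDP stage: the quadratic
`(x, w) ↦ (1/2)(M⁻¹x − q)ᵀM(M⁻¹x − q) + (ρ/2)‖Ax + Bw + c‖² + (μ/2)‖w‖²`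
has the unique global minimizer `x* = Sq − ρSAᵀGc`, `w* = −E(Ax* + c)`. -/
theorem stmt_16 (r p s : ℕ) (M : Matrix (Fin r) (Fin r) ℝ) (hM : M.PosDef)
    (A : Matrix (Fin p) (Fin r) ℝ) (B : Matrix (Fin p) (Fin s) ℝ)
    (μ ρ : ℝ) (hμ : 0 < μ) (hρ : 0 < ρ)
    (q : Fin r → ℝ) (c : Fin p → ℝ) :
    let E := ((μ / ρ) • (1 : Matrix (Fin s) (Fin s) ℝ) + Bᵀ * B)⁻¹ * Bᵀ
    let G := (1 : Matrix (Fin p) (Fin p) ℝ) - B * E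
    let S := (M⁻¹ + ρ • (Aᵀ * G * A))⁻¹
    let f : (Fin r → ℝ) → (Fin s → ℝ) → ℝ := fun x w =>
      (1 / 2) * ((M⁻¹ *ᵥ x - q) ⬝ᵥ (M *ᵥ (M⁻¹ *ᵥ x - q)))
        + (ρ / 2) * ((A *ᵥ x + B *ᵥ w + c) ⬝ᵥ (A *ᵥ x + B *ᵥ w + c))
        + (μ / 2) * (w ⬝ᵥ w)
    let xstar := S *ᵥ q - ρ • ((S * Aᵀ * G) *ᵥ c)
    let wstar := -(E *ᵥ (A *ᵥ xstar + c))
    ∀ (x : Fin r → ℝ) (w : Fin s → ℝ), (x, w) ≠ (xstar, wstar) →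
      f xstar wstar < f x w := by
  intro E G S f xstar wstar x w hne
  have hK := posDef_smul_one_add_transpose_mul_self B (div_pos hμ hρ)
  have hKE : ((μ / ρ) • (1 : Matrix (Fin s) (Fin s) ℝ) + Bᵀ * B) * E = Bᵀ :=
    mul_nonsing_inv_cancel_left _ _ ((isUnit_iff_isUnit_det _).1 hK.isUnit)
  have hBG : Bᵀ * G = (μ / ρ) • E := transpose_mul_one_sub_mul hKE
  have hG : G.PosSemidef := posSemidef_one_sub_mul (div_pos hμ hρ) hBG
  have hH : (M⁻¹ + ρ • (Aᵀ * G * A)).PosDef := by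
    refine hM.inv.add_posSemidef (PosSemidef.smul ?_ hρ.le)
    simpa only [conjTranspose_eq_transpose_of_trivial] using hG.conjTranspose_mul_mul_same A
  have hHS : (M⁻¹ + ρ • (Aᵀ * G * A)) * S = 1 :=
    mul_nonsing_inv _ ((isUnit_iff_isUnit_det _).1 hH.isUnit)
  have hxstar : (M⁻¹ + ρ • (Aᵀ * G * A)) *ᵥ xstar = q - ρ • ((Aᵀ * G) *ᵥ c) := by
    simp only [xstar]
    rw [mulVec_sub, mulVec_smul, mulVec_mulVec, mulVec_mulVec, Matrix.mul_assoc S,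
      ← Matrix.mul_assoc _ S, hHS, one_mulVec, Matrix.one_mul]
  have hres : A *ᵥ xstar + B *ᵥ wstar + c = G *ᵥ (A *ᵥ xstar + c) := by
    simp only [wstar, G]
    rw [sub_mulVec, one_mulVec, mulVec_neg, mulVec_mulVec]
    abel
  refine lt_of_stationary hM A B hμ hρ q c ?_ ?_ hne
  · rw [add_mulVec, smul_mulVec] at hxstar
    rw [hres, mulVec_mulVec, mulVec_add, mulVec_mulVec, smul_add, sub_add_eq_add_sub,
      ← add_assoc, hxstar]
    abel
  · rw [hres, mulVec_mulVec, hBG, smul_mulVec, smul_smul, mul_div_cancel₀ _ hρ.ne']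
    simp only [wstar]
    rw [smul_neg, add_neg_cancel]
end

section
/- Let N ≥ 1, μ_w > 0, and for each j ∈ [N+1] let ρ_j > 0, A_j ∈ ℝ^{r_j×r_{j−1}}, B_j ∈ ℝ^{r_j×s_j}, c_j ∈ ℝ^{r_j}, with x₀ ∈ ℝ^{r_0} fixed; set δ_j = 1 for j ≤ N and δ_{N+1} = 0. Then the function 𝒢(w₁,…,w_{N+1}, x₁,…,x_N) := Σ_{j=1}^{N+1} [(ρ_j/2)‖δ_j x_j − A_j x_{j−1} − B_j w_j − c_j‖² + (μ_w/2)‖w_j‖²] (where the term δ_{N+1}x_{N+1} is absent, i.e. the last residual is −A_{N+1}x_N − B_{N+1}w_{N+1} − c_{N+1}) has a unique global minimizer on ℝ^{s_1}×⋯×ℝ^{s_{N+1}} × ℝ^{r_1}×⋯×ℝ^{r_N}. -/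
open Matrix

/-- The extended state family: `extState r N x₀ x 0 = x₀`, `extState r N x₀ x j = x_{j}`
for `1 ≤ j ≤ N`, and `0` (the placeholder for the absent `x_{N+1}`) beyond. -/
def extState (r : ℕ → ℕ) (N : ℕ) (x₀ : Fin (r 0) → ℝ)
    (x : (j : Fin N) → Fin (r ((j : ℕ) + 1)) → ℝ) (j : ℕ) : Fin (r j) → ℝ :=
  if h : j = 0 then fun i => x₀ (Fin.cast (congrArg r h) i)
  else if h' : j - 1 < N then
    fun i => x ⟨j - 1, h'⟩ (Fin.cast (congrArg r (by omega : j = j - 1 + 1)) i)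
  else 0

/-- The Gauss–Newton objective
`𝒢(w, x) = Σ_{j=1}^{N+1} [(ρ_j/2)‖δ_j x_j − A_j x_{j−1} − B_j w_j − c_j‖² + (μ_w/2)‖w_j‖²]`,
where `δ_j = 1` for `j ≤ N` and `δ_{N+1} = 0` (the last residual is
`−A_{N+1}x_N − B_{N+1}w_{N+1} − c_{N+1}`).  Here the index `j : Fin (N+1)` represents the
stage `j+1 ∈ [N+1]` of the paper. -/
noncomputable def gnObj (N : ℕ) (μw : ℝ) (r : ℕ → ℕ) (s : Fin (N + 1) → ℕ)
    (ρ : Fin (N + 1) → ℝ)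
    (A : (j : Fin (N + 1)) → Matrix (Fin (r ((j : ℕ) + 1))) (Fin (r (j : ℕ))) ℝ)
    (B : (j : Fin (N + 1)) → Matrix (Fin (r ((j : ℕ) + 1))) (Fin (s j)) ℝ)
    (c : (j : Fin (N + 1)) → Fin (r ((j : ℕ) + 1)) → ℝ)
    (x₀ : Fin (r 0) → ℝ)
    (z : ((j : Fin (N + 1)) → Fin (s j) → ℝ) × ((j : Fin N) → Fin (r ((j : ℕ) + 1)) → ℝ)) :
    ℝ :=
  ∑ j : Fin (N + 1),
    ((ρ j / 2) *
        (((if (j : ℕ) < N then extState r N x₀ z.2 ((j : ℕ) + 1) else 0)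
            - A j *ᵥ extState r N x₀ z.2 (j : ℕ) - B j *ᵥ z.1 j - c j) ⬝ᵥ
          ((if (j : ℕ) < N then extState r N x₀ z.2 ((j : ℕ) + 1) else 0)
            - A j *ᵥ extState r N x₀ z.2 (j : ℕ) - B j *ᵥ z.1 j - c j))
      + (μw / 2) * (z.1 j ⬝ᵥ z.1 j))

/-- A weighted linear least-squares problem with injective linear part has a unique minimizer. -/
lemma exists_forall_weighted_sum_sq_lt {V ι : Type*} [AddCommGroup V] [Module ℝ V] [Fintype ι]
    (L : V →ₗ[ℝ] ι → ℝ) (hL : Function.Injective L) (b a : ι → ℝ) (ha : ∀ k, 0 < a k) :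
    ∃ z, ∀ z', z' ≠ z → ∑ k, a k * (L z k + b k) ^ 2 < ∑ k, a k * (L z' k + b k) ^ 2 := by
  let D : (ι → ℝ) →ₗ[ℝ] EuclideanSpace ℝ ι :=
    { toFun := fun v => WithLp.toLp 2 fun k => √(a k) * v k
      map_add' := fun u v => by ext k; simp [mul_add]
      map_smul' := fun t v => by ext k; simp [mul_left_comm] }
  have hD (v : ι → ℝ) : ∑ k, a k * v k ^ 2 = ‖D v‖ ^ 2 := by
    simp [D, EuclideanSpace.norm_sq_eq, mul_pow, Real.sq_sqrt (ha _).le]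
  have hD0 (v : ι → ℝ) (hv : D v = 0) : v = 0 := by
    ext k
    have hk : √(a k) * v k = 0 := congrArg (fun u : EuclideanSpace ℝ ι => u k) hv
    exact (mul_eq_zero.mp hk).resolve_left (Real.sqrt_pos.mpr (ha k)).ne'
  let K := LinearMap.range (D ∘ₗ L)
  obtain ⟨z, hz⟩ : ∃ z, D (L z) = K.starProjection (-D b) :=
    K.starProjection_apply_mem (-D b)
  refine ⟨z, fun z' hne => ?_⟩
  have horth : inner ℝ (D (L (z' - z))) (D (L z + b)) = 0 := by
    have h := K.sub_starProjection_mem_orthogonal (-D b) (D (L (z' - z))) ⟨z' - z, rfl⟩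
    rw [← hz] at h
    rw [← neg_eq_zero, ← inner_neg_right, ← h, map_add]
    congr 1
    abel
  have hpos : 0 < ‖D (L (z' - z))‖ := by
    refine norm_pos_iff.mpr fun h => hne ?_
    rw [← sub_eq_zero]
    exact hL ((hD0 _ h).trans (map_zero L).symm)
  have hsplit : D (L z' + b) = D (L (z' - z)) + D (L z + b) := by
    simp only [map_add, map_sub]
    abel
  have h1 := hD (L z + b)
  have h2 := hD (L z' + b)
  simp only [Pi.add_apply] at h1 h2
  rw [h1, h2, hsplit, norm_add_sq_real, horth]
  nlinarith

lemma extState_add (r : ℕ → ℕ) (N : ℕ) (x₀ y₀ : Fin (r 0) → ℝ)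
    (x y : (j : Fin N) → Fin (r ((j : ℕ) + 1)) → ℝ) (j : ℕ) :
    extState r N (x₀ + y₀) (x + y) j = extState r N x₀ x j + extState r N y₀ y j := by
  unfold extState
  split_ifs <;> ext i <;> simp

lemma extState_smul (r : ℕ → ℕ) (N : ℕ) (t : ℝ) (x₀ : Fin (r 0) → ℝ)
    (x : (j : Fin N) → Fin (r ((j : ℕ) + 1)) → ℝ) (j : ℕ) :
    extState r N (t • x₀) (t • x) j = t • extState r N x₀ x j := by
  unfold extState
  split_ifs <;> ext i <;> simp

lemma extState_succ (r : ℕ → ℕ) (N : ℕ) (x₀ : Fin (r 0) → ℝ)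
    (x : (j : Fin N) → Fin (r ((j : ℕ) + 1)) → ℝ) (j : Fin N) :
    extState r N x₀ x ((j : ℕ) + 1) = x j := by
  ext i
  simp [extState]

/-- The residual `δ_j x_j − A_j x_{j−1} − B_j w_j − c_j` of the Gauss–Newton objective. -/
def gnResidual (N : ℕ) (r : ℕ → ℕ) (s : Fin (N + 1) → ℕ)
    (A : (j : Fin (N + 1)) → Matrix (Fin (r ((j : ℕ) + 1))) (Fin (r (j : ℕ))) ℝ)
    (B : (j : Fin (N + 1)) → Matrix (Fin (r ((j : ℕ) + 1))) (Fin (s j)) ℝ)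
    (c : (j : Fin (N + 1)) → Fin (r ((j : ℕ) + 1)) → ℝ)
    (x₀ : Fin (r 0) → ℝ)
    (z : ((j : Fin (N + 1)) → Fin (s j) → ℝ) × ((j : Fin N) → Fin (r ((j : ℕ) + 1)) → ℝ))
    (j : Fin (N + 1)) : Fin (r ((j : ℕ) + 1)) → ℝ :=
  (if (j : ℕ) < N then extState r N x₀ z.2 ((j : ℕ) + 1) else 0)
    - A j *ᵥ extState r N x₀ z.2 (j : ℕ) - B j *ᵥ z.1 j - c j

section Residual

variable {N : ℕ} {r : ℕ → ℕ} {s : Fin (N + 1) → ℕ}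
  (A : (j : Fin (N + 1)) → Matrix (Fin (r ((j : ℕ) + 1))) (Fin (r (j : ℕ))) ℝ)
  (B : (j : Fin (N + 1)) → Matrix (Fin (r ((j : ℕ) + 1))) (Fin (s j)) ℝ)

lemma gnResidual_add (c d : (j : Fin (N + 1)) → Fin (r ((j : ℕ) + 1)) → ℝ)
    (x₀ y₀ : Fin (r 0) → ℝ)
    (z z' : ((j : Fin (N + 1)) → Fin (s j) → ℝ) × ((j : Fin N) → Fin (r ((j : ℕ) + 1)) → ℝ))
    (j : Fin (N + 1)) :
    gnResidual N r s A B (c + d) (x₀ + y₀) (z + z') j =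
      gnResidual N r s A B c x₀ z j + gnResidual N r s A B d y₀ z' j := by
  simp only [gnResidual, Prod.fst_add, Prod.snd_add, extState_add, Pi.add_apply, mulVec_add]
  split_ifs <;> abel

lemma gnResidual_smul (t : ℝ) (c : (j : Fin (N + 1)) → Fin (r ((j : ℕ) + 1)) → ℝ)
    (x₀ : Fin (r 0) → ℝ)
    (z : ((j : Fin (N + 1)) → Fin (s j) → ℝ) × ((j : Fin N) → Fin (r ((j : ℕ) + 1)) → ℝ))
    (j : Fin (N + 1)) :
    gnResidual N r s A B (t • c) (t • x₀) (t • z) j = t • gnResidual N r s A B c x₀ z j := by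
  simp only [gnResidual, Prod.smul_fst, Prod.smul_snd, extState_smul, Pi.smul_apply, mulVec_smul]
  split_ifs <;> simp [smul_sub]

/-- The linear part of the Gauss–Newton residuals, stacked with the weights. -/
def gnLinear :
    ((j : Fin (N + 1)) → Fin (s j) → ℝ) × ((j : Fin N) → Fin (r ((j : ℕ) + 1)) → ℝ) →ₗ[ℝ]
      ((Σ j : Fin (N + 1), Fin (r ((j : ℕ) + 1))) ⊕ (Σ j : Fin (N + 1), Fin (s j)) → ℝ) where
  toFun z := Sum.elim (fun k => gnResidual N r s A B 0 0 z k.1 k.2) (fun k => z.1 k.1 k.2)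
  map_add' z z' := by
    ext (k | k)
    · simpa using congrFun (gnResidual_add A B 0 0 0 0 z z' k.1) k.2
    · simp
  map_smul' t z := by
    ext (k | k)
    · simpa using congrFun (gnResidual_smul A B t 0 0 z k.1) k.2
    · simp

lemma gnLinear_injective : Function.Injective (gnLinear A B) := by
  refine (injective_iff_map_eq_zero _).mpr fun z hz => ?_
  have hw : z.1 = 0 := by
    ext j i
    exact congrFun hz (Sum.inr ⟨j, i⟩)
  have hres (j : Fin (N + 1)) : gnResidual N r s A B 0 0 z j = 0 := by
    ext i
    exact congrFun hz (Sum.inl ⟨j, i⟩)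
  have hx (j : ℕ) (hj : j ≤ N) : extState r N 0 z.2 j = 0 := by
    induction j with
    | zero => ext i; simp [extState]
    | succ j ih =>
      have h := hres ⟨j, by omega⟩
      simpa [gnResidual, hw, ih (by omega), show j < N from hj] using h
  refine Prod.ext hw (funext fun j => ?_)
  rw [← extState_succ r N 0 z.2 j, hx _ j.2]
  rfl

end Residual

/-- The Gauss–Newton subproblem has a unique global minimizer. -/
theorem stmt_17 (N : ℕ) (hN : 1 ≤ N) (μw : ℝ) (hμ : 0 < μw)
    (r : ℕ → ℕ) (s : Fin (N + 1) → ℕ)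
    (ρ : Fin (N + 1) → ℝ) (hρ : ∀ j, 0 < ρ j)
    (A : (j : Fin (N + 1)) → Matrix (Fin (r ((j : ℕ) + 1))) (Fin (r (j : ℕ))) ℝ)
    (B : (j : Fin (N + 1)) → Matrix (Fin (r ((j : ℕ) + 1))) (Fin (s j)) ℝ)
    (c : (j : Fin (N + 1)) → Fin (r ((j : ℕ) + 1)) → ℝ)
    (x₀ : Fin (r 0) → ℝ) :
    ∃ z : ((j : Fin (N + 1)) → Fin (s j) → ℝ) × ((j : Fin N) → Fin (r ((j : ℕ) + 1)) → ℝ),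
      ∀ z' : ((j : Fin (N + 1)) → Fin (s j) → ℝ) × ((j : Fin N) → Fin (r ((j : ℕ) + 1)) → ℝ),
        z' ≠ z → gnObj N μw r s ρ A B c x₀ z < gnObj N μw r s ρ A B c x₀ z' := by
  obtain ⟨z, hz⟩ := exists_forall_weighted_sum_sq_lt (gnLinear A B) (gnLinear_injective A B)
    (Sum.elim (fun k => gnResidual N r s A B c x₀ 0 k.1 k.2) 0)
    (Sum.elim (fun k => ρ k.1 / 2) fun _ => μw / 2)
    (by rintro (k | k) <;> simp [hρ, hμ])
  have hobj (z) : gnObj N μw r s ρ A B c x₀ z = ∑ k,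
      (Sum.elim (fun k => ρ k.1 / 2) fun _ => μw / 2 :
        (Σ j : Fin (N + 1), Fin (r ((j : ℕ) + 1))) ⊕ (Σ j : Fin (N + 1), Fin (s j)) → ℝ) k *
      (gnLinear A B z k + Sum.elim (fun k => gnResidual N r s A B c x₀ 0 k.1 k.2) 0 k) ^ 2 := by
    have hres (j) : gnResidual N r s A B c x₀ z j =
        gnResidual N r s A B 0 0 z j + gnResidual N r s A B c x₀ 0 j := by
      simpa using gnResidual_add A B 0 c 0 x₀ z 0 j
    change ∑ j, (ρ j / 2 * (gnResidual N r s A B c x₀ z j ⬝ᵥ gnResidual N r s A B c x₀ z j)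
      + μw / 2 * (z.1 j ⬝ᵥ z.1 j)) = _
    simp only [hres, Fintype.sum_sum_type, Fintype.sum_sigma, Finset.sum_add_distrib,
      dotProduct, Finset.mul_sum, gnLinear, LinearMap.coe_mk, AddHom.coe_mk, Sum.elim_inl,
      Sum.elim_inr, Pi.add_apply, Pi.zero_apply, add_zero, sq]
  exact ⟨z, fun z' hne => by simpa only [hobj] using hz z' hne⟩
end
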